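/- Let (h,[·,·],⟨·,·⟩) be a λ-Einstein Lorentzian nilpotent Lie algebra with nondegenerate Euclidean center, with attributes (g,⟨·,·⟩_g,[·,·]_g), (Z(h),⟨·,·⟩_z) and ω. If ω satisfies ω(ad_u* v, w) + ω(v, ad_u* w) = 0 for all u,v,w ∈ g, then (g,[·,·]_g,⟨·,·⟩_g) is a Ricci soliton: its Ricci operator satisfies Ric_g = λ·Id_g + (1/2)D, where D is a derivation of (g,[·,·]_g). -/

import Mathlib

open Module LinearMap

noncomputable section

/-- A bilinear form is Lorentzian if it admits an orthonormal basis with exactly one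
timelike vector, i.e. it has signature `(1, dim − 1)`. -/
def IsLorentzianForm {H : Type*} [AddCommGroup H] [Module ℝ H]
    (B : H →ₗ[ℝ] H →ₗ[ℝ] ℝ) : Prop :=
  ∃ (n : ℕ) (b : Basis (Fin (n + 1)) ℝ H),
    (∀ i j, i ≠ j → B (b i) (b j) = 0) ∧
    B (b 0) (b 0) = -1 ∧ ∀ i, i ≠ 0 → B (b i) (b i) = 1

/-- The trace of `T` computed in a basis and its dual basis for a nondegenerate form. -/
theorem trace_eq_sum_dualBasis {ι V : Type*} [Fintype ι] [DecidableEq ι]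
    [AddCommGroup V] [Module ℝ V]
    (B : LinearMap.BilinForm ℝ V) (hB : B.Nondegenerate) (hsymm : B.IsSymm)
    (b : Basis ι ℝ V) (T : Module.End ℝ V) :
    LinearMap.trace ℝ V T = ∑ i, B (T (b i)) (B.dualBasis hB b i) := by
  rw [LinearMap.trace_eq_matrix_trace ℝ b, Matrix.trace]
  refine Finset.sum_congr rfl fun i _ => ?_
  rw [Matrix.diag_apply, LinearMap.toMatrix_apply]
  nth_rewrite 1 [← LinearMap.BilinForm.dualBasis_dualBasis hB hsymm b]
  rw [LinearMap.BilinForm.dualBasis_repr_apply]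

/-- Endomorphisms adjoint to each other for a nondegenerate symmetric form have the same trace. -/
theorem trace_eq_of_adjoint {V : Type*} [AddCommGroup V] [Module ℝ V] [Module.Finite ℝ V]
    (B : LinearMap.BilinForm ℝ V) (hB : B.Nondegenerate) (hsymm : B.IsSymm)
    {S T : Module.End ℝ V} (h : ∀ x y, B (S x) y = B (T y) x) :
    LinearMap.trace ℝ V S = LinearMap.trace ℝ V T := by
  let b := Module.finBasis ℝ V
  rw [trace_eq_sum_dualBasis B hB hsymm b,
    trace_eq_sum_dualBasis B hB hsymm (B.dualBasis hB b),
    LinearMap.BilinForm.dualBasis_dualBasis hB hsymm b]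
  exact Finset.sum_congr rfl fun i _ => h _ _

/-- Let `(h,[·,·],⟨·,·⟩)` be a `λ`-Einstein Lorentzian nilpotent Lie algebra
with nondegenerate Euclidean center, with attributes `(g, ⟨·,·⟩_g, [·,·]_g)`, `(Z(h), ⟨·,·⟩_z)`
and `ω`.  If `ω(ad_u* v, w) + ω(v, ad_u* w) = 0` for all `u,v,w ∈ g`, then
`(g, [·,·]_g, ⟨·,·⟩_g)` is a Ricci soliton: `Ric_g = λ·Id_g + ½ D` with `D` a derivation of
`(g, [·,·]_g)`. -/
theorem statement5
    {H : Type*} [LieRing H] [LieAlgebra ℝ H] [Module.Finite ℝ H]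
    (B : H →ₗ[ℝ] H →ₗ[ℝ] ℝ)
    (hsymm : ∀ u v : H, B u v = B v u)
    (hnd : ∀ u : H, (∀ v : H, B u v = 0) → u = 0)
    (hLor : IsLorentzianForm B)
    (hnilp : ∃ k, LieModule.lowerCentralSeries ℝ H H k = ⊥)
    (hZnd : ∀ z ∈ LieAlgebra.center ℝ H,
      (∀ w ∈ LieAlgebra.center ℝ H, B z w = 0) → z = 0)
    (hZeucl : ∀ z ∈ LieAlgebra.center ℝ H, z ≠ 0 → 0 < B z z)
    -- `g` is the orthogonal complement of the center
    (g : Submodule ℝ H)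
    (hg : ∀ u : H, u ∈ g ↔ ∀ z ∈ LieAlgebra.center ℝ H, B u z = 0)
    -- `P`, `Q` are the projections onto `g` and `Z(h)` in `h = g ⊕ Z(h)`
    (P Q : H →ₗ[ℝ] H)
    (hP : ∀ u : H, P u ∈ g)
    (hQ : ∀ u : H, Q u ∈ LieAlgebra.center ℝ H)
    (hPQ : ∀ u : H, P u + Q u = u)
    -- `adStar u` is the adjoint of `ad u` in `h` with respect to `B`
    (adStar : H → Module.End ℝ H)
    (hadStar : ∀ u v w : H, B (adStar u v) w = B v ⁅u, w⁆)
    -- `Jm u` is the skew-symmetric endomorphism `J_u(v) = ad_v*(u)` of `h`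
    (Jm : H → Module.End ℝ H)
    (hJm : ∀ u v w : H, B (Jm u v) w = B u ⁅v, w⁆)
    -- `adgStar u` is the adjoint of `ad_u^g` in `(g, [·,·]_g)`, extended by `0` on `Z(h)`
    (adgStar : H → Module.End ℝ H)
    (hadgStarg : ∀ u ∈ g, ∀ v ∈ g, adgStar u v ∈ g)
    (hadgStar0 : ∀ u ∈ g, ∀ z ∈ LieAlgebra.center ℝ H, adgStar u z = 0)
    (hadgStar : ∀ u ∈ g, ∀ v ∈ g, ∀ w ∈ g, B (adgStar u v) w = B v (P ⁅u, w⁆))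
    -- `Jg u` (for `u ∈ g`) is the endomorphism `J_u` of `(g,[·,·]_g)`, extended by `0` on `Z(h)`
    (Jg : H → Module.End ℝ H)
    (hJgg : ∀ u ∈ g, ∀ v ∈ g, Jg u v ∈ g)
    (hJg0 : ∀ u ∈ g, ∀ z ∈ LieAlgebra.center ℝ H, Jg u z = 0)
    (hJg : ∀ u ∈ g, ∀ v ∈ g, ∀ w ∈ g, B (Jg u v) w = B u (P ⁅v, w⁆))
    -- `W u` is the extension to `h` of `ω_u* : Z(h) → g` (vanishing on `g`)
    (W : H → Module.End ℝ H)
    (hWg : ∀ u x : H, W u x ∈ g)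
    (hWz : ∀ u : H, ∀ v ∈ g, W u v = 0)
    (hWdef : ∀ u ∈ g, ∀ x ∈ LieAlgebra.center ℝ H, ∀ v ∈ g,
      B (W u x) v = B (Q ⁅u, v⁆) x)
    -- `D : g → g` is the symmetric endomorphism with `⟨Du, v⟩_g = tr(ω_u* ∘ ω_v)`
    (D : Module.End ℝ H)
    (hDg : ∀ u ∈ g, D u ∈ g)
    (hDdef : ∀ u ∈ g, ∀ v ∈ g,
      B (D u) v = LinearMap.trace ℝ H
        (W u ∘ₗ (Q ∘ₗ (LieAlgebra.ad ℝ H v : Module.End ℝ H))))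
    (lam : ℝ)
    -- `h` is `λ`-Einstein
    (hEinstein : ∀ u v : H,
      -(1/2) * LinearMap.trace ℝ H ((LieAlgebra.ad ℝ H u : Module.End ℝ H) ∘ₗ adStar v)
        - (1/4) * LinearMap.trace ℝ H (Jm u ∘ₗ Jm v) = lam * B u v)
    -- `ω` satisfies `ω(ad_u* v, w) + ω(v, ad_u* w) = 0` for `u,v,w ∈ g`
    (hom : ∀ u ∈ g, ∀ v ∈ g, ∀ w ∈ g,
      Q ⁅adgStar u v, w⁆ + Q ⁅v, adgStar u w⁆ = 0) :
    -- conclusion: `g` is a Ricci soliton, `Ric_g = λ Id + ½ D` with `D` a derivation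
    (∀ u ∈ g, ∀ v ∈ g,
      -(1/2) * LinearMap.trace ℝ H
          ((P ∘ₗ (LieAlgebra.ad ℝ H u : Module.End ℝ H)) ∘ₗ adgStar v)
        - (1/4) * LinearMap.trace ℝ H (Jg u ∘ₗ Jg v)
      = lam * B u v + (1/2) * B (D u) v) ∧
    (∀ u ∈ g, ∀ v ∈ g, D (P ⁅u, v⁆) = P ⁅D u, v⁆ + P ⁅u, D v⁆) := by
  have nondeg : LinearMap.BilinForm.Nondegenerate B :=
    ⟨hnd, fun u h => hnd u fun v => (hsymm u v).trans (h v)⟩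
  have symm : LinearMap.BilinForm.IsSymm B := ⟨hsymm⟩
  have ext_form : ∀ x y : H, (∀ w, B x w = B y w) → x = y := fun x y h =>
    sub_eq_zero.1 (hnd _ fun w => by simp [h w])
  have center_lie : ∀ z ∈ LieAlgebra.center ℝ H, ∀ x : H, ⁅x, z⁆ = 0 := fun z hz x =>
    (LieModule.mem_maxTrivSubmodule ℝ H H z).1 hz x
  have lie_center : ∀ z ∈ LieAlgebra.center ℝ H, ∀ x : H, ⁅z, x⁆ = 0 := fun z hz x => by
    rw [← lie_skew, center_lie z hz, neg_zero]
  have orth : ∀ u ∈ g, ∀ z ∈ LieAlgebra.center ℝ H, B u z = 0 := fun u hu => (hg u).1 hu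
  have form_P : ∀ u ∈ g, ∀ x, B u (P x) = B u x := fun u hu x => by
    conv_rhs => rw [← hPQ x, map_add, orth u hu _ (hQ x), add_zero]
  have form_Q : ∀ z ∈ LieAlgebra.center ℝ H, ∀ x, B z (Q x) = B z x := fun z hz x => by
    conv_rhs => rw [← hPQ x, map_add, hsymm z (P x), orth _ (hP x) z hz, zero_add]
  have lie_P : ∀ x y : H, ⁅x, P y⁆ = ⁅x, y⁆ := fun x y => by
    conv_rhs => rw [← hPQ y, lie_add, center_lie _ (hQ y), add_zero]
  have Q_eq_zero : ∀ u ∈ g, Q u = 0 := fun u hu =>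
    hZnd _ (hQ u) fun w hw => by
      rw [hsymm, form_Q w hw, hsymm, orth u hu w hw]
  have P_eq_zero : ∀ z ∈ LieAlgebra.center ℝ H, P z = 0 := fun z hz =>
    ext_form _ _ fun w => by
      rw [← form_P _ (hP z), hsymm, form_P _ (hP w), orth _ (hP w) z hz]; simp
  have P_eq_self : ∀ u ∈ g, P u = u := fun u hu => by
    simpa [Q_eq_zero u hu] using hPQ u
  have Q_eq_self : ∀ z ∈ LieAlgebra.center ℝ H, Q z = z := fun z hz => by
    simpa [P_eq_zero z hz] using hPQ z
  have Jm_mem : ∀ u v : H, Jm u v ∈ g := fun u v => (hg _).2 fun z hz => by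
    rw [hJm, center_lie z hz, map_zero]
  have Jm_center : ∀ u : H, ∀ z ∈ LieAlgebra.center ℝ H, Jm u z = 0 := fun u z hz =>
    ext_form _ _ fun w => by rw [hJm, lie_center z hz]; simp
  have Jm_eq_Jg : ∀ u ∈ g, Jm u = Jg u := fun u hu => LinearMap.ext fun x => by
    rw [← hPQ x, map_add, map_add, Jm_center u _ (hQ x), hJg0 u hu _ (hQ x), add_zero, add_zero]
    refine ext_form _ _ fun w => ?_
    rw [hJm, ← form_P _ (hJgg u hu _ (hP x)), hJg u hu _ (hP x) _ (hP w), form_P u hu, lie_P]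
  have W_eq_Jm : ∀ u ∈ g, ∀ x, W u x = Jm (Q x) u := fun u hu x => by
    have hx : W u x = W u (Q x) := by
      conv_lhs => rw [← hPQ x, map_add, hWz u _ (hP x), zero_add]
    refine ext_form _ _ fun w => ?_
    rw [hx, hJm, ← form_P _ (hWg u _), hWdef u hu _ (hQ x) _ (hP w), hsymm, form_Q _ (hQ x), lie_P]
  have form_QadW : ∀ u, ∀ v ∈ g, ∀ x y,
      B ((Q ∘ₗ (LieAlgebra.ad ℝ H u : Module.End ℝ H) ∘ₗ W v) x) y
        = B (Jm (Q y) u) (Jm (Q x) v) := fun u v hv x y => by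
    rw [hJm, ← W_eq_Jm v hv, LinearMap.comp_apply, LinearMap.comp_apply, LieAlgebra.ad_apply,
      ← form_Q _ (hQ _) y, hsymm, form_Q _ (hQ y)]
  have D_eq_trace : ∀ u ∈ g, ∀ v ∈ g, B (D u) v =
      LinearMap.trace ℝ H (Q ∘ₗ (LieAlgebra.ad ℝ H v : Module.End ℝ H) ∘ₗ W u) :=
    fun u hu v hv => by
      rw [hDdef u hu v hv, LinearMap.trace_comp_comm']; rfl
  have D_symm : ∀ u ∈ g, ∀ v ∈ g, B (D u) v = B (D v) u := fun u hu v hv => by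
    rw [D_eq_trace u hu v hv, D_eq_trace v hv u hu]
    exact trace_eq_of_adjoint B nondeg symm fun x y => by
      rw [form_QadW v u hu, form_QadW u v hv, hsymm]
  constructor
  · intro u hu v hv
    have adStar_P : adStar v ∘ₗ P = adgStar v := LinearMap.ext fun x => by
      have hx : adgStar v x = adgStar v (P x) := by
        conv_lhs => rw [← hPQ x, map_add, hadgStar0 v hv _ (hQ x), add_zero]
      refine ext_form _ _ fun w => ?_
      rw [LinearMap.comp_apply, hx, hadStar, ← form_P _ (hadgStarg v hv _ (hP x)),
        hadgStar v hv _ (hP x) _ (hP w), form_P _ (hP x), lie_P]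
    have adStar_Q : adStar v ∘ₗ Q = W v := LinearMap.ext fun x => ext_form _ _ fun w => by
      rw [LinearMap.comp_apply, hadStar, W_eq_Jm v hv, hJm]
    have trace_P : LinearMap.trace ℝ H
          (P ∘ₗ ((LieAlgebra.ad ℝ H u : Module.End ℝ H) ∘ₗ adStar v)) =
        LinearMap.trace ℝ H ((P ∘ₗ (LieAlgebra.ad ℝ H u : Module.End ℝ H)) ∘ₗ adgStar v) := by
      have hPP : P ∘ₗ P = P := LinearMap.ext fun x => P_eq_self _ (hP x)
      rw [← adStar_P, ← LinearMap.comp_assoc, ← LinearMap.comp_assoc,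
        LinearMap.trace_comp_comm' P, ← LinearMap.comp_assoc, ← LinearMap.comp_assoc, hPP]
    have trace_Q : LinearMap.trace ℝ H
          (Q ∘ₗ ((LieAlgebra.ad ℝ H u : Module.End ℝ H) ∘ₗ adStar v)) = B (D u) v := by
      have hQQ : Q ∘ₗ Q = Q := LinearMap.ext fun x => Q_eq_self _ (hQ x)
      rw [D_symm u hu v hv, D_eq_trace v hv u hu, ← adStar_Q, ← LinearMap.comp_assoc,
        ← LinearMap.comp_assoc, ← LinearMap.comp_assoc,
        LinearMap.trace_comp_comm' Q, ← LinearMap.comp_assoc, ← LinearMap.comp_assoc, hQQ]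
    have trace_split : LinearMap.trace ℝ H
          ((LieAlgebra.ad ℝ H u : Module.End ℝ H) ∘ₗ adStar v) =
        LinearMap.trace ℝ H ((P ∘ₗ (LieAlgebra.ad ℝ H u : Module.End ℝ H)) ∘ₗ adgStar v)
          + B (D u) v := by
      rw [← trace_P, ← trace_Q, ← map_add]
      exact congrArg _ (LinearMap.ext fun x => (hPQ _).symm)
    have h := hEinstein u v
    rw [trace_split, Jm_eq_Jg u hu, Jm_eq_Jg v hv] at h
    linarith
  · have Jm_cocycle : ∀ z : H, ∀ u ∈ g, ∀ v ∈ g,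
        Jm z ⁅u, v⁆ = adgStar v (Jm z u) - adgStar u (Jm z v) := fun z u hu v hv => by
      have form_adgStar : ∀ u ∈ g, ∀ x ∈ g, ∀ w, B (adgStar u x) w = B x ⁅u, w⁆ :=
        fun u hu x hx w => by
          rw [← form_P _ (hadgStarg u hu x hx), hadgStar u hu x hx _ (hP w), form_P x hx, lie_P]
      refine ext_form _ _ fun w => ?_
      rw [map_sub, LinearMap.sub_apply, form_adgStar v hv _ (Jm_mem z u),
        form_adgStar u hu _ (Jm_mem z v), hJm, hJm, hJm, lie_lie, map_sub]
    have Jm_adgStar : ∀ z ∈ LieAlgebra.center ℝ H, ∀ u ∈ g, ∀ x ∈ g,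
        Jm z (adgStar u x) = -P ⁅u, Jm z x⁆ := fun z hz u hu x hx => by
      refine ext_form _ _ fun w => ?_
      have h := congrArg (B z) (hom u hu x hx _ (hP w))
      rw [map_add, map_zero, form_Q z hz, form_Q z hz, lie_P, ← hJm, ← hJm,
        hsymm (Jm z x), hadgStar u hu _ (hP w) _ (Jm_mem z x), hsymm (P w), form_P _ (hP _)] at h
      rw [map_neg, LinearMap.neg_apply]
      exact eq_neg_of_add_eq_zero_left h
    have Jm_Jm_derivation : ∀ z ∈ LieAlgebra.center ℝ H, ∀ z' : H, ∀ u ∈ g, ∀ v ∈ g,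
        Jm z (Jm z' (P ⁅u, v⁆)) = P ⁅Jm z (Jm z' u), v⁆ + P ⁅u, Jm z (Jm z' v)⁆ :=
      fun z hz z' u hu v hv => by
        have h : Jm z' (P ⁅u, v⁆) = Jm z' ⁅u, v⁆ := by
          conv_rhs => rw [← hPQ ⁅u, v⁆, map_add, Jm_center z' _ (hQ _), add_zero]
        rw [h, Jm_cocycle z' u hu v hv, map_sub, Jm_adgStar z hz v hv _ (Jm_mem z' u),
          Jm_adgStar z hz u hu _ (Jm_mem z' v), ← lie_skew v, map_neg]
        abel
    let b := Module.finBasis ℝ H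
    have D_eq_sum : ∀ u ∈ g, D u =
        -∑ i, Jm (Q (LinearMap.BilinForm.dualBasis B nondeg b i)) (Jm (Q (b i)) u) :=
      fun u hu => by
        refine ext_form _ _ fun w => ?_
        rw [← form_P _ (hDg u hu), D_eq_trace u hu _ (hP w), trace_eq_sum_dualBasis B nondeg symm b,
          map_neg, map_sum, LinearMap.neg_apply, LinearMap.sum_apply, ← Finset.sum_neg_distrib]
        refine Finset.sum_congr rfl fun i _ => ?_
        rw [form_QadW _ u hu, hJm, hJm, ← lie_skew, map_neg, lie_P]
    intro u hu v hv
    rw [D_eq_sum _ (hP _), D_eq_sum u hu, D_eq_sum v hv, neg_lie, lie_neg, sum_lie,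
      lie_sum, map_neg, map_neg, map_sum, map_sum, ← neg_add, ← Finset.sum_add_distrib]
    exact congrArg _ (Finset.sum_congr rfl fun i _ => Jm_Jm_derivation _ (hQ _) _ u hu v hv)
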